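/- Let A ⊆ ℕ be a set which is not ultimately periodic. Then for all finite sets X, Y ⊆ ℕ, the cardinalities |X| and |Y| are equal if and only if for every finite set Z ⊆ ℕ with Z ∩ (X ∪ Y) = ∅, one has |X ∪ Z| ∈ A iff |Y ∪ Z| ∈ A. -/

import Mathlib

/-- `A ⊆ ℕ` is ultimately periodic. -/
def UltimatelyPeriodic (A : Set ℕ) : Prop :=
  ∃ M p : ℕ, 1 ≤ p ∧ ∀ x : ℕ, M ≤ x → (x ∈ A ↔ x + p ∈ A)

/-- Translating membership in `A` between two distinct offsets forces ultimate periodicity. -/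
theorem ultimatelyPeriodic_of_add_mem_iff {A : Set ℕ} {a b : ℕ} (hab : a < b)
    (h : ∀ k, a + k ∈ A ↔ b + k ∈ A) : UltimatelyPeriodic A := by
  refine ⟨a, b - a, by omega, fun x hx => ?_⟩
  have hk := h (x - a)
  rwa [show a + (x - a) = x by omega, show b + (x - a) = x + (b - a) by omega] at hk

theorem stmt_3 (A : Set ℕ) (hA : ¬ UltimatelyPeriodic A) (X Y : Finset ℕ) :
    X.card = Y.card ↔
      ∀ Z : Finset ℕ, Disjoint Z (X ∪ Y) →
        ((X ∪ Z).card ∈ A ↔ (Y ∪ Z).card ∈ A) := by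
  have hcard : ∀ Z : Finset ℕ, Disjoint Z (X ∪ Y) →
      (X ∪ Z).card = X.card + Z.card ∧ (Y ∪ Z).card = Y.card + Z.card := by
    intro Z hZ
    rw [Finset.disjoint_union_right] at hZ
    exact ⟨Finset.card_union_of_disjoint hZ.1.symm, Finset.card_union_of_disjoint hZ.2.symm⟩
  constructor
  · intro h Z hZ
    rw [(hcard Z hZ).1, (hcard Z hZ).2, h]
  · intro h
    have hshift : ∀ k, X.card + k ∈ A ↔ Y.card + k ∈ A := by
      intro k
      obtain ⟨Z, hZ, rfl⟩ := (X ∪ Y).finite_toSet.infinite_compl.exists_subset_card_eq k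
      have hdisj : Disjoint Z (X ∪ Y) :=
        Finset.disjoint_left.2 fun x hx hxy => hZ hx hxy
      rw [← (hcard Z hdisj).1, ← (hcard Z hdisj).2]
      exact h Z hdisj
    by_contra hne
    rcases lt_or_gt_of_ne hne with hlt | hlt
    · exact hA (ultimatelyPeriodic_of_add_mem_iff hlt hshift)
    · exact hA (ultimatelyPeriodic_of_add_mem_iff hlt fun k => (hshift k).symm)
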